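/- (Per-step decrease on a successful Full-Eval iteration.) Let f : ℝⁿ → ℝ be L-smooth. Let c, τ ∈ (0,1), β̄ > 0, u_g > 0, u_p > 0, κ > 0, and let x, g, p ∈ ℝⁿ with p ≠ 0 and β ∈ (0, β̄] be such that: ‖∇f(x) − g‖ ≤ u_g β ‖g‖; ⟨−g, p⟩ > κ ‖g‖ ‖p‖; ‖g‖ ≤ u_p ‖p‖; the sufficient decrease condition holds at β, i.e. f(x + β p) ≤ f(x) + c β ⟨g, p⟩; and either β = β̄ or f(x + (β/τ) p) − f(x) > c (β/τ) ⟨g, p⟩. Then f(x) − f(x + β p) ≥ (M / (β̄ u_g + 1)²) ‖∇f(x)‖², where M = c · min{ β̄ κ / u_p, 2 τ κ² (1 − c) / (2 u_g u_p + L) }. -/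

import Mathlib

open scoped RealInnerProductSpace

theorem descent_aux {n : ℕ}
    (f : EuclideanSpace ℝ (Fin n) → ℝ) (L : ℝ)
    (hdiff : Differentiable ℝ f)
    (hlip : ∀ y z : EuclideanSpace ℝ (Fin n),
      ‖gradient f y - gradient f z‖ ≤ L * ‖y - z‖)
    (x p : EuclideanSpace ℝ (Fin n)) (s : ℝ) (hs : 0 ≤ s) :
    f (x + s • p) - f x ≤ s * ⟪gradient f x, p⟫ + L / 2 * s ^ 2 * ‖p‖ ^ 2 := by
  let φ : ℝ → ℝ := fun t => f (x + t • p) - (t * ⟪gradient f x, p⟫ + L / 2 * t ^ 2 * ‖p‖ ^ 2)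
  have hd : ∀ t : ℝ, HasDerivAt φ (⟪gradient f (x + t • p), p⟫
      - (⟪gradient f x, p⟫ + L * t * ‖p‖ ^ 2)) t := by
    intro t
    have h1 : HasDerivAt (fun t : ℝ => x + t • p) p t := by
      simpa using ((hasDerivAt_id t).smul_const p).const_add x
    have h2 := (hdiff (x + t • p)).hasGradientAt.hasFDerivAt.comp_hasDerivAt t h1
    have h3 : HasDerivAt (fun t : ℝ => t * ⟪gradient f x, p⟫ + L / 2 * t ^ 2 * ‖p‖ ^ 2)
        (⟪gradient f x, p⟫ + L * t * ‖p‖ ^ 2) t := by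
      have := ((hasDerivAt_id t).mul_const ⟪gradient f x, p⟫).add
        ((((hasDerivAt_id t).pow 2).const_mul (L / 2)).mul_const (‖p‖ ^ 2))
      refine HasDerivAt.congr_deriv this ?_
      simp only [id, Nat.cast_ofNat, one_mul, mul_one]
      ring
    have h4 := h2.sub h3
    exact h4
  have hanti : AntitoneOn φ (Set.Ici 0) := by
    apply antitoneOn_of_deriv_nonpos (convex_Ici 0)
    · exact fun t _ => (hd t).continuousAt.continuousWithinAt
    · exact fun t _ => (hd t).differentiableAt.differentiableWithinAt
    · intro t ht
      rw [interior_Ici] at ht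
      have ht' : 0 < t := ht
      rw [(hd t).deriv]
      have h1 := real_inner_le_norm (gradient f (x + t • p) - gradient f x) p
      rw [inner_sub_left] at h1
      have h2 := hlip (x + t • p) x
      rw [add_sub_cancel_left, norm_smul, Real.norm_of_nonneg ht'.le] at h2
      have h3 := mul_le_mul_of_nonneg_right h2 (norm_nonneg p)
      nlinarith
  have := hanti (Set.mem_Ici.2 le_rfl) (Set.mem_Ici.2 hs) hs
  simp only [φ, zero_smul, add_zero, zero_mul, ne_eq, OfNat.ofNat_ne_zero, not_false_eq_true,
    zero_pow, mul_zero, sub_zero] at this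
  linarith

/-- Per-step decrease on a successful Full-Eval iteration:
`f(x) − f(x + β p) ≥ (M/(β̄ u_g + 1)²) ‖∇f(x)‖²`, where
`M = c · min{β̄ κ/u_p, 2τκ²(1−c)/(2 u_g u_p + L)}`. -/
theorem full_low_eval_per_step_decrease {n : ℕ}
    (f : EuclideanSpace ℝ (Fin n) → ℝ) (L : ℝ) (hL : 0 < L)
    (hdiff : Differentiable ℝ f)
    (hlip : ∀ y z : EuclideanSpace ℝ (Fin n),
      ‖gradient f y - gradient f z‖ ≤ L * ‖y - z‖)
    (c τ βbar u_g u_p κ : ℝ)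
    (hc : 0 < c) (hc1 : c < 1) (hτ : 0 < τ) (hτ1 : τ < 1)
    (hβbar : 0 < βbar) (hug : 0 < u_g) (hup : 0 < u_p) (hκ : 0 < κ)
    (x g p : EuclideanSpace ℝ (Fin n)) (hp : p ≠ 0)
    (β : ℝ) (hβpos : 0 < β) (hβle : β ≤ βbar)
    (herr : ‖gradient f x - g‖ ≤ u_g * β * ‖g‖)
    (hangle : ⟪-g, p⟫ > κ * (‖g‖ * ‖p‖))
    (hgp : ‖g‖ ≤ u_p * ‖p‖)
    (hsdc : f (x + β • p) ≤ f x + c * β * ⟪g, p⟫)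
    (hfail : β = βbar ∨ f (x + (β / τ) • p) - f x > c * (β / τ) * ⟪g, p⟫) :
    f x - f (x + β • p) ≥
      c * min (βbar * κ / u_p) (2 * τ * κ ^ 2 * (1 - c) / (2 * u_g * u_p + L)) /
        (βbar * u_g + 1) ^ 2 * ‖gradient f x‖ ^ 2 := by
  have hG := norm_nonneg g
  have hP : 0 < ‖p‖ := norm_pos_iff.2 hp
  rw [inner_neg_left] at hangle
  set m := min (βbar * κ / u_p) (2 * τ * κ ^ 2 * (1 - c) / (2 * u_g * u_p + L)) with hm
  have h1c : 0 < 1 - c := by linarith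
  have hD : 0 < 2 * u_g * u_p + L := by positivity
  have hm0 : 0 ≤ m := by
    apply le_min <;> positivity
  have key : m * ‖g‖ ≤ β * κ * ‖p‖ := by
    rcases hfail with h | h
    · have h1 : m * ‖g‖ ≤ βbar * κ / u_p * (u_p * ‖p‖) :=
        mul_le_mul (min_le_left _ _) hgp hG (by positivity)
      have h2 : βbar * κ / u_p * (u_p * ‖p‖) = β * κ * ‖p‖ := by
        rw [h]; field_simp
      linarith
    · set s := β / τ with hs
      have hs0 : 0 < s := by positivity
      have hβs : β ≤ s := by
        rw [hs, le_div_iff₀ hτ]; nlinarith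
      have hd := descent_aux f L hdiff hlip x p s hs0.le
      have h1 : c * ⟪g, p⟫ < ⟪gradient f x, p⟫ + L / 2 * s * ‖p‖ ^ 2 := by
        apply lt_of_mul_lt_mul_left _ hs0.le
        nlinarith
      have h2 := real_inner_le_norm (gradient f x - g) p
      rw [inner_sub_left] at h2
      have h3 := mul_le_mul_of_nonneg_right herr hP.le
      have h4 : (1 - c) * (κ * (‖g‖ * ‖p‖)) ≤ (1 - c) * (-⟪g, p⟫) :=
        mul_le_mul_of_nonneg_left hangle.le h1c.le
      have h5 : u_g * β * ‖g‖ * ‖p‖ ≤ u_g * s * (u_p * ‖p‖) * ‖p‖ := by gcongr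
      have h6 : (1 - c) * κ * ‖g‖ ≤ s * (2 * u_g * u_p + L) / 2 * ‖p‖ := by
        apply le_of_mul_le_mul_right _ hP
        nlinarith
      have h7 : m * ‖g‖ ≤ 2 * τ * κ ^ 2 * (1 - c) / (2 * u_g * u_p + L) * ‖g‖ :=
        mul_le_mul_of_nonneg_right (min_le_right _ _) hG
      refine h7.trans ?_
      rw [div_mul_eq_mul_div, div_le_iff₀ hD]
      have h8 := mul_le_mul_of_nonneg_left h6 (show 0 ≤ 2 * τ * κ by positivity)
      have h9 : s * τ = β := by rw [hs]; field_simp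
      rw [← h9]
      nlinarith
  have hgrad : ‖gradient f x‖ ≤ (βbar * u_g + 1) * ‖g‖ := by
    have h1 := norm_add_le (gradient f x - g) g
    rw [sub_add_cancel] at h1
    have h2 : u_g * β * ‖g‖ ≤ u_g * βbar * ‖g‖ := by gcongr
    linarith
  have hsq : ‖gradient f x‖ ^ 2 ≤ (βbar * u_g + 1) ^ 2 * ‖g‖ ^ 2 := by
    rw [← mul_pow]; gcongr
  have hB : 0 < (βbar * u_g + 1) ^ 2 := by positivity
  have hfin : c * m / (βbar * u_g + 1) ^ 2 * ‖gradient f x‖ ^ 2 ≤ c * m * ‖g‖ ^ 2 := by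
    rw [div_mul_eq_mul_div, div_le_iff₀ hB]
    have := mul_le_mul_of_nonneg_left hsq (mul_nonneg hc.le hm0)
    linarith
  have hk2 := mul_le_mul_of_nonneg_left key (mul_nonneg hc.le hG)
  have hk3 := mul_le_mul_of_nonneg_left hangle.le (mul_pos hc hβpos).le
  have : c * m * ‖g‖ ^ 2 ≤ -(c * β * ⟪g, p⟫) := by nlinarith
  linarith
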